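/- Let λ ∈ [0,1] and define f(x) = ((1+3λ)/2)^x + 3((1−λ)/2)^x for real x ≥ 1 (with the convention 0^x = 0). Then for every s ≥ 1 and all positive integers l₁,…,l_s with l₁+⋯+l_s = r: 2^{−(s−1)} · ∏_{i=1}^s f(l_i) ≤ max{ 2, f(r) }. -/

import Mathlib

/-- The sequence `n ↦ aⁿ + 3bⁿ`. -/
noncomputable def powSum (a b : ℝ) (n : ℕ) : ℝ := a ^ n + 3 * b ^ n

section powSum

variable {a b : ℝ}

lemma powSum_nonneg (ha : 0 ≤ a) (hb : 0 ≤ b) (n : ℕ) : 0 ≤ powSum a b n := by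
  unfold powSum; positivity

lemma two_mul_powSum_succ_le (ha : 0 ≤ a) (hb : 0 ≤ b) (n : ℕ) :
    2 * powSum a b (n + 1) ≤ powSum a b n + powSum a b (n + 2) := by
  have h1 : 0 ≤ a ^ n * (a - 1) ^ 2 := by positivity
  have h2 : 0 ≤ b ^ n * (b - 1) ^ 2 := by positivity
  unfold powSum
  linear_combination h1 + 3 * h2

lemma powSum_mul_le (hb : 0 ≤ b) (hab : b ≤ a) (m n : ℕ) :
    powSum a b (m + 1) * powSum a b (n + 1) ≤ powSum a b 1 * powSum a b (m + n + 1) := by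
  have h1 : 0 ≤ a ^ m - b ^ m := sub_nonneg.2 (pow_le_pow_left₀ hb hab m)
  have h2 : 0 ≤ a ^ n - b ^ n := sub_nonneg.2 (pow_le_pow_left₀ hb hab n)
  have h3 : 0 ≤ a * b * ((a ^ m - b ^ m) * (a ^ n - b ^ n)) :=
    mul_nonneg (mul_nonneg (hb.trans hab) hb) (mul_nonneg h1 h2)
  unfold powSum
  linear_combination 3 * h3

lemma powSum_succ_le_or (ha : 0 ≤ a) (hb : 0 ≤ b) (n : ℕ) :
    powSum a b (n + 1) ≤ powSum a b 1 ∨ powSum a b (n + 1) ≤ powSum a b (n + 2) := by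
  induction n with
  | zero => exact .inl le_rfl
  | succ n ih =>
    have h := two_mul_powSum_succ_le ha hb (n + 1)
    by_cases hn : powSum a b (n + 1) ≤ powSum a b (n + 2)
    · right; linarith
    · left; rcases ih with ih | ih <;> linarith

lemma monotone_max_powSum (ha : 0 ≤ a) (hb : 0 ≤ b) :
    Monotone fun n ↦ max (powSum a b 1) (powSum a b (n + 1)) := by
  refine monotone_nat_of_le_succ fun n ↦ max_le (le_max_left _ _) ?_
  rcases powSum_succ_le_or ha hb n with h | h
  · exact h.trans (le_max_left _ _)
  · exact h.trans (le_max_right _ _)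

lemma powSum_le_max (ha : 0 ≤ a) (hb : 0 ≤ b) {m n : ℕ} (hm : 0 < m) (hmn : m ≤ n) :
    powSum a b m ≤ max (powSum a b 1) (powSum a b n) := by
  obtain ⟨m, rfl⟩ := Nat.exists_eq_succ_of_ne_zero hm.ne'
  obtain ⟨n, rfl⟩ := Nat.exists_eq_succ_of_ne_zero (hm.trans_le hmn).ne'
  exact (le_max_right _ _).trans (monotone_max_powSum ha hb (Nat.succ_le_succ_iff.1 hmn))

lemma powSum_mul_le_max (hb : 0 ≤ b) (hab : b ≤ a) {m n : ℕ} (hm : 0 < m) (hn : 0 < n) :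
    powSum a b m * powSum a b n ≤ powSum a b 1 * max (powSum a b 1) (powSum a b (m + n)) := by
  have ha := hb.trans hab
  obtain ⟨m, rfl⟩ := Nat.exists_eq_succ_of_ne_zero hm.ne'
  obtain ⟨n, rfl⟩ := Nat.exists_eq_succ_of_ne_zero hn.ne'
  exact (powSum_mul_le hb hab m n).trans (mul_le_mul_of_nonneg_left
    (powSum_le_max ha hb (by lia) (by lia)) (powSum_nonneg ha hb 1))

lemma powSum_mul_max_le (hb : 0 ≤ b) (hab : b ≤ a) {m n : ℕ} (hm : 0 < m) (hn : 0 < n) :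
    powSum a b m * max (powSum a b 1) (powSum a b n) ≤
      powSum a b 1 * max (powSum a b 1) (powSum a b (m + n)) := by
  have ha := hb.trans hab
  rw [mul_max_of_nonneg _ _ (powSum_nonneg ha hb m)]
  refine max_le ?_ (powSum_mul_le_max hb hab hm hn)
  rw [mul_comm]
  exact mul_le_mul_of_nonneg_left (powSum_le_max ha hb hm (by lia)) (powSum_nonneg ha hb 1)

lemma powSum_one_mul_prod_le {ι : Type*} (hb : 0 ≤ b) (hab : b ≤ a) {l : ι → ℕ}
    (hl : ∀ i, 0 < l i) {S : Finset ι} (hS : S.Nonempty) :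
    powSum a b 1 * ∏ i ∈ S, powSum a b (l i) ≤
      powSum a b 1 ^ S.card * max (powSum a b 1) (powSum a b (∑ i ∈ S, l i)) := by
  have ha := hb.trans hab
  induction hS using Finset.Nonempty.cons_induction with
  | singleton i =>
    simpa using mul_le_mul_of_nonneg_left (le_max_right _ _) (powSum_nonneg ha hb 1)
  | cons i S hi hS ih =>
    rw [Finset.prod_cons, Finset.sum_cons, Finset.card_cons, pow_succ, mul_assoc, mul_left_comm]
    calc _ ≤ powSum a b (l i) *
          (powSum a b 1 ^ S.card * max (powSum a b 1) (powSum a b (∑ j ∈ S, l j))) :=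
          mul_le_mul_of_nonneg_left ih (powSum_nonneg ha hb _)
      _ = powSum a b 1 ^ S.card *
          (powSum a b (l i) * max (powSum a b 1) (powSum a b (∑ j ∈ S, l j))) :=
          mul_left_comm _ _ _
      _ ≤ _ := mul_le_mul_of_nonneg_left
          (powSum_mul_max_le hb hab (hl i) (Finset.sum_pos (fun j _ ↦ hl j) hS))
          (pow_nonneg (powSum_nonneg ha hb 1) _)

end powSum

/-- for `λ ∈ [0,1]` and `f(x) = ((1+3λ)/2)^x + 3((1−λ)/2)^x` (real powers, with
the `rpow` convention `0^x = 0` for `x ≠ 0`), for all `s ≥ 1` and positive integers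
`l₁,…,l_s` summing to `r`: `2^{−(s−1)} ∏_i f(l_i) ≤ max{2, f(r)}`. -/
theorem rpow_prod_le_max (lam : ℝ) (hl0 : 0 ≤ lam) (hl1 : lam ≤ 1)
    (s : ℕ) (hs : 1 ≤ s) (len : Fin s → ℕ) (hlen : ∀ i, 0 < len i)
    (r : ℕ) (hr : r = ∑ i, len i)
    (f : ℝ → ℝ) (hf : ∀ x : ℝ, f x = ((1 + 3 * lam) / 2) ^ x + 3 * ((1 - lam) / 2) ^ x) :
    ((2 : ℝ) ^ (s - 1))⁻¹ * ∏ i, f (len i) ≤ max 2 (f r) := by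
  have hfn (n : ℕ) : f n = powSum ((1 + 3 * lam) / 2) ((1 - lam) / 2) n := by
    simp only [hf, powSum, Real.rpow_natCast]
  have h1 : powSum ((1 + 3 * lam) / 2) ((1 - lam) / 2) 1 = 2 := by
    unfold powSum; ring
  have : NeZero s := ⟨by lia⟩
  have h := powSum_one_mul_prod_le (a := (1 + 3 * lam) / 2) (b := (1 - lam) / 2)
    (by linarith) (by linarith) hlen (Finset.univ_nonempty (α := Fin s))
  obtain ⟨s, rfl⟩ := Nat.exists_eq_succ_of_ne_zero (NeZero.ne s)
  rw [h1, Finset.card_univ, Fintype.card_fin, pow_succ', mul_assoc, ← hr] at h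
  simp only [hfn, Nat.add_one_sub_one]
  rw [inv_mul_le_iff₀ (by positivity)]
  exact le_of_mul_le_mul_left h two_pos
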